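/- There exists a universal constant C > 0 such that the following holds. Let N be a positive integer, let Ā ∈ ℝ^{N×N} be a real symmetric matrix with eigenvalues λ_1, …, λ_N, let k be a positive integer, let p ∈ [0, 1/2], let R ≥ 0, and let H be a nonempty finite set of vectors in ℝ^N with ‖G‖_∞ ≤ R for every G ∈ H. Let ε be a transductive Rademacher vector with parameter p. Then E_ε[ sup_{G ∈ H} |⟨ε, Ā^k G⟩| ] ≤ C (Σ_{j=1}^N |λ_j|^k) ( E_ε[ sup_{G ∈ H} |⟨ε, G⟩| ] + √N R ). -/

import Mathlib

open Finset

/-- Expectation with respect to a transductive Rademacher vector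
`ε ∈ ℝ^N` with i.i.d. coordinates: `P(ε_i = 1) = P(ε_i = -1) = p`,
`P(ε_i = 0) = 1 - 2p`. -/
noncomputable def tExp (N : ℕ) (p : ℝ) (f : (Fin N → ℝ) → ℝ) : ℝ :=
  ∑ s : Fin N → Fin 3,
    (∏ i, (![p, p, 1 - 2 * p] : Fin 3 → ℝ) (s i)) *
      f (fun i => (![(1 : ℝ), -1, 0]) (s i))

lemma sum_prod_weight_mul_prod (N : ℕ) (p : ℝ) (g : Fin N → Fin 3 → ℝ) :
    ∑ s : Fin N → Fin 3, (∏ i, (![p, p, 1 - 2 * p] : Fin 3 → ℝ) (s i)) * ∏ i, g i (s i) =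
      ∏ i, ∑ t, (![p, p, 1 - 2 * p] : Fin 3 → ℝ) t * g i t := by
  simp_rw [← Finset.prod_mul_distrib]
  exact (Fintype.prod_sum fun i t => (![p, p, 1 - 2 * p] : Fin 3 → ℝ) t * g i t).symm

lemma tExp_const (N : ℕ) (p c : ℝ) : tExp N p (fun _ => c) = c := by
  have h := sum_prod_weight_mul_prod N p (fun _ _ => 1)
  have h1 : p + p + (1 - 2 * p) = 1 := by ring
  simp only [Finset.prod_const_one, mul_one, Fin.sum_univ_three, Matrix.cons_val, h1] at h
  simp only [tExp, ← Finset.sum_mul, h, one_mul]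

lemma tExp_mono {N : ℕ} {p : ℝ} (hp : 0 ≤ p) (hp' : p ≤ 1 / 2) {f g : (Fin N → ℝ) → ℝ}
    (h : ∀ x, f x ≤ g x) : tExp N p f ≤ tExp N p g := by
  refine Finset.sum_le_sum fun s _ => mul_le_mul_of_nonneg_left (h _) ?_
  refine Finset.prod_nonneg fun i _ => ?_
  generalize s i = t
  fin_cases t <;> simp <;> linarith

lemma tExp_add (N : ℕ) (p : ℝ) (f g : (Fin N → ℝ) → ℝ) :
    tExp N p (fun x => f x + g x) = tExp N p f + tExp N p g := by
  simp [tExp, mul_add, Finset.sum_add_distrib]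

lemma tExp_const_mul (N : ℕ) (p c : ℝ) (f : (Fin N → ℝ) → ℝ) :
    tExp N p (fun x => c * f x) = c * tExp N p f := by
  simp only [tExp, Finset.mul_sum]
  exact Finset.sum_congr rfl fun _ _ => by ring

lemma tExp_sum {ι : Type*} (S : Finset ι) (N : ℕ) (p : ℝ) (f : ι → (Fin N → ℝ) → ℝ) :
    tExp N p (fun x => ∑ j ∈ S, f j x) = ∑ j ∈ S, tExp N p (f j) := by
  simp only [tExp, Finset.mul_sum]
  exact Finset.sum_comm

lemma tExp_coord_mul_coord (N : ℕ) (p : ℝ) (a b : Fin N) :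
    tExp N p (fun x => x a * x b) = if a = b then 2 * p else 0 := by
  have h := sum_prod_weight_mul_prod N p (fun i t =>
    (if i = a then (![(1 : ℝ), -1, 0]) t else 1) * (if i = b then (![(1 : ℝ), -1, 0]) t else 1))
  simp only [Finset.prod_mul_distrib, Finset.prod_ite_eq', Finset.mem_univ, if_true] at h
  rw [tExp, h]
  split_ifs with hab
  · subst hab
    rw [Finset.prod_eq_single a]
    · simp [Fin.sum_univ_three]; ring
    · intro i _ hi
      simp [Fin.sum_univ_three, hi]; ring
    · simp
  · refine Finset.prod_eq_zero (Finset.mem_univ a) ?_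
    simp [Fin.sum_univ_three, hab]

lemma tExp_sq_linear (N : ℕ) (p : ℝ) (u : Fin N → ℝ) :
    tExp N p (fun x => (∑ n, x n * u n) ^ 2) = 2 * p * ∑ n, u n ^ 2 := by
  have h (x : Fin N → ℝ) :
      (∑ n, x n * u n) ^ 2 = ∑ a, ∑ b, (u a * u b) * (x a * x b) := by
    rw [sq, Finset.sum_mul_sum]
    exact Finset.sum_congr rfl fun _ _ => Finset.sum_congr rfl fun _ _ => by ring
  simp_rw [h, tExp_sum, tExp_const_mul, tExp_coord_mul_coord]
  simp only [mul_ite, mul_zero, Finset.sum_ite_eq, Finset.mem_univ, if_true, Finset.mul_sum]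
  exact Finset.sum_congr rfl fun _ _ => by ring

lemma tExp_abs_linear_le_one {N : ℕ} {p : ℝ} (hp : 0 ≤ p) (hp' : p ≤ 1 / 2) (u : Fin N → ℝ)
    (hu : ∑ n, u n ^ 2 = 1) : tExp N p (fun x => |∑ n, x n * u n|) ≤ 1 := by
  have h : tExp N p (fun x => |∑ n, x n * u n|) ≤
      tExp N p (fun x => 1 / 2 + 1 / 2 * (∑ n, x n * u n) ^ 2) := by
    refine tExp_mono hp hp' fun x => ?_
    rw [← sq_abs (∑ n, x n * u n)]
    nlinarith [sq_nonneg (|∑ n, x n * u n| - 1)]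
  rw [tExp_add, tExp_const, tExp_const_mul, tExp_sq_linear, hu] at h
  linarith

lemma Matrix.IsHermitian.pow_mulVec_eigenvectorBasis {N : ℕ} {A : Matrix (Fin N) (Fin N) ℝ}
    (hA : A.IsHermitian) (k : ℕ) (j : Fin N) :
    (A ^ k).mulVec (hA.eigenvectorBasis j) =
      hA.eigenvalues j ^ k • (hA.eigenvectorBasis j : Fin N → ℝ) := by
  induction k with
  | zero => simp
  | succ k ih =>
    rw [pow_succ, ← Matrix.mulVec_mulVec, hA.mulVec_eigenvectorBasis, Matrix.mulVec_smul, ih,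
      smul_smul, pow_succ, mul_comm]

lemma Matrix.IsHermitian.sum_mul_pow_mulVec {N : ℕ} {A : Matrix (Fin N) (Fin N) ℝ}
    (hA : A.IsHermitian) (k : ℕ) (x G : Fin N → ℝ) :
    ∑ n, x n * (A ^ k).mulVec G n =
      ∑ j, hA.eigenvalues j ^ k * inner ℝ (hA.eigenvectorBasis j) (WithLp.toLp 2 G) *
        ∑ n, x n * hA.eigenvectorBasis j n := by
  have hG : G = ∑ j, (inner ℝ (hA.eigenvectorBasis j) (WithLp.toLp 2 G) : ℝ) •
      (hA.eigenvectorBasis j : Fin N → ℝ) := by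
    have := congrArg WithLp.ofLp (hA.eigenvectorBasis.sum_repr' (WithLp.toLp 2 G))
    simpa using this.symm
  conv_lhs => rw [hG]
  simp only [Matrix.mulVec_sum, Matrix.mulVec_smul, hA.pow_mulVec_eigenvectorBasis,
    Finset.sum_apply, Pi.smul_apply, smul_eq_mul, Finset.mul_sum]
  rw [Finset.sum_comm]
  exact Finset.sum_congr rfl fun _ _ => Finset.sum_congr rfl fun _ _ => by ring

lemma norm_toLp_le_sqrt_mul {N : ℕ} {R : ℝ} (hR : 0 ≤ R) (G : Fin N → ℝ) (h : ∀ i, |G i| ≤ R) :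
    ‖WithLp.toLp 2 G‖ ≤ Real.sqrt N * R := by
  rw [EuclideanSpace.norm_eq, ← Real.sqrt_sq hR, ← Real.sqrt_mul (Nat.cast_nonneg N)]
  refine Real.sqrt_le_sqrt ?_
  calc ∑ i, ‖G i‖ ^ 2 ≤ ∑ _i : Fin N, R ^ 2 :=
        Finset.sum_le_sum fun i _ => pow_le_pow_left₀ (norm_nonneg _) (h i) 2
    _ = N * R ^ 2 := by simp

/-- The key intermediate spectral bound: the Rademacher complexity of one graph
convolution of order `k` is controlled by the power sum of the eigenvalue
spectrum of the symmetric matrix `Ā`. -/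
theorem convolution_rademacher_spectral_bound :
    ∃ C : ℝ, 0 < C ∧
      ∀ (N : ℕ), 0 < N →
      ∀ (A : Matrix (Fin N) (Fin N) ℝ) (hA : A.IsHermitian)
        (k : ℕ), 0 < k →
      ∀ (p R : ℝ), 0 ≤ p → p ≤ 1 / 2 → 0 ≤ R →
      ∀ (H : Finset (Fin N → ℝ)) (hH : H.Nonempty),
        (∀ G ∈ H, ∀ i, |G i| ≤ R) →
      tExp N p (fun ε => H.sup' hH (fun G => |∑ n, ε n * (A ^ k).mulVec G n|))
        ≤ C * (∑ j, |hA.eigenvalues j| ^ k) *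
            (tExp N p (fun ε => H.sup' hH (fun G => |∑ n, ε n * G n|))
              + Real.sqrt (N : ℝ) * R) := by
  refine ⟨1, one_pos, fun N _ A hA k _ p R hp hp' hR H hH hb => ?_⟩
  have hunit (j : Fin N) : ∑ n, hA.eigenvectorBasis j n ^ 2 = 1 := by
    have := EuclideanSpace.real_norm_sq_eq (hA.eigenvectorBasis j)
    rw [hA.eigenvectorBasis.orthonormal.1 j] at this
    linarith
  have hsup : 0 ≤ tExp N p (fun ε => H.sup' hH (fun G => |∑ n, ε n * G n|)) := by
    rw [← tExp_const N p 0]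
    obtain ⟨G, hG⟩ := hH
    exact tExp_mono hp hp' fun x =>
      (abs_nonneg _).trans (Finset.le_sup' (fun G : Fin N → ℝ => |∑ n, x n * G n|) hG)
  calc tExp N p (fun ε => H.sup' hH (fun G => |∑ n, ε n * (A ^ k).mulVec G n|))
      ≤ tExp N p (fun ε => ∑ j, |hA.eigenvalues j| ^ k * (Real.sqrt N * R) *
          |∑ n, ε n * hA.eigenvectorBasis j n|) := by
        refine tExp_mono hp hp' fun x => Finset.sup'_le _ _ fun G hG => ?_
        rw [hA.sum_mul_pow_mulVec]
        refine (Finset.abs_sum_le_sum_abs _ _).trans (Finset.sum_le_sum fun j _ => ?_)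
        rw [abs_mul, abs_mul, abs_pow]
        gcongr
        refine (abs_real_inner_le_norm _ _).trans ?_
        rw [hA.eigenvectorBasis.orthonormal.1 j, one_mul]
        exact norm_toLp_le_sqrt_mul hR G (hb G hG)
    _ = ∑ j, |hA.eigenvalues j| ^ k * (Real.sqrt N * R) *
          tExp N p (fun ε => |∑ n, ε n * hA.eigenvectorBasis j n|) := by
        simp_rw [tExp_sum, tExp_const_mul]
    _ ≤ ∑ j, |hA.eigenvalues j| ^ k * (Real.sqrt N * R) :=
        Finset.sum_le_sum fun j _ => mul_le_of_le_one_right (by positivity)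
          (tExp_abs_linear_le_one hp hp' _ (hunit j))
    _ = 1 * (∑ j, |hA.eigenvalues j| ^ k) * (Real.sqrt N * R) := by
        rw [one_mul, Finset.sum_mul]
    _ ≤ _ := by
        gcongr
        linarith
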